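/- arXiv:1503.01251 — 3 statements merged into one kernel-verified Lean document; each statement's English description precedes it below -/
import Mathlib

section
/- Let (𝓕, 𝓙) be a generalized almost para-Hermitian structure on a finite-dimensional real vector space V, with 𝓗 = 𝓙∘𝓕, 𝐇 the i-eigenspace of 𝓗^ℂ and τ : V^ℂ → 𝐇 the inverse of the projection to V^ℂ. Define F, J ∈ End(V^ℂ) by F X = pr_{V^ℂ}(𝓕^ℂ(τ X)) and J X = pr_{V^ℂ}(𝓙^ℂ(τ X)). Then J = i F; in particular J² = -Id and γ₀^ℂ(J X, Y) + γ₀^ℂ(X, J Y) = 0, where γ₀ is the symmetric nondegenerate form on V associated with the structure. -/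
noncomputable section

open TensorProduct

attribute [local instance 3000] TensorProduct.addCommMonoid TensorProduct.leftModule

/-- The "big tangent space" `V ⊕ V*`. -/
abbrev Big (V : Type) [AddCommGroup V] [Module ℝ V] : Type := V × Module.Dual ℝ V

variable (V : Type) [AddCommGroup V] [Module ℝ V]

/-- The pairing metric `g((X,α),(Y,β)) = (α Y + β X)/2` on `V ⊕ V*`. -/
def gP : Big V →ₗ[ℝ] Big V →ₗ[ℝ] ℝ :=
  LinearMap.mk₂ ℝ (fun u v => (u.2 v.1 + v.2 u.1) / 2)
    (fun m₁ m₂ n => by simp; ring)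
    (fun c m n => by simp; ring)
    (fun m n₁ n₂ => by simp; ring)
    (fun c m n => by simp; ring)

/-- A generalized almost para-complex structure on `V`. -/
def IsGenParaCx (F : Big V →ₗ[ℝ] Big V) : Prop :=
  F ∘ₗ F = LinearMap.id ∧ ∀ u v, gP V (F u) v = - gP V u (F v)

/-- A generalized almost complex structure on `V`. -/
def IsGenCx (J : Big V →ₗ[ℝ] Big V) : Prop :=
  J ∘ₗ J = - LinearMap.id ∧ ∀ u v, gP V (J u) v = - gP V u (J v)

/-- The bilinear form `γ(α,β) = -2 g(𝓕(0,α), 𝓙(0,β))` on `V*`. -/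
def gammaOf (F J : Big V →ₗ[ℝ] Big V) (α β : Module.Dual ℝ V) : ℝ :=
  -2 * gP V (F (0, α)) (J (0, β))

/-- A generalized almost para-Hermitian structure on `V`: a commuting pair of a
generalized almost para-complex structure and a generalized almost complex structure
whose associated bilinear form `γ` on `V*` is nondegenerate. -/
def IsGAPH (F J : Big V →ₗ[ℝ] Big V) : Prop :=
  IsGenParaCx V F ∧ IsGenCx V J ∧ F ∘ₗ J = J ∘ₗ F ∧
    ∀ α, (∀ β, gammaOf V F J α β = 0) → α = 0

/-- Complexification of `V`. -/
abbrev Vc : Type := ℂ ⊗[ℝ] V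

/-- Complexification of the big space `V ⊕ V*`. -/
abbrev Bc : Type := ℂ ⊗[ℝ] Big V

/-- The projection `(V ⊕ V*)^ℂ → V^ℂ`. -/
def prV : Bc V →ₗ[ℂ] Vc V := LinearMap.baseChange ℂ (LinearMap.fst ℝ V (Module.Dual ℝ V))

/-- The inclusion `V^ℂ → (V ⊕ V*)^ℂ`, `X ↦ (X, 0)`. -/
def inV : Vc V →ₗ[ℂ] Bc V := LinearMap.baseChange ℂ (LinearMap.inl ℝ V (Module.Dual ℝ V))

/-- The complexified pairing metric on `(V ⊕ V*)^ℂ`. -/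
def gc : Bc V →ₗ[ℂ] Bc V →ₗ[ℂ] ℂ := LinearMap.BilinForm.baseChange ℂ (gP V)

/-- Complex-bilinear extension of a bilinear form on `V` to `V^ℂ`. -/
def bcB (B : LinearMap.BilinForm ℝ V) : Vc V →ₗ[ℂ] Vc V →ₗ[ℂ] ℂ :=
  LinearMap.BilinForm.baseChange ℂ B

/-- The `μ`-eigenspace of an endomorphism of `(V ⊕ V*)^ℂ`. -/
def eigSp (T : Bc V →ₗ[ℂ] Bc V) (μ : ℂ) : Submodule ℂ (Bc V) where
  carrier := {u | T u = μ • u}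
  add_mem' := by
    intro a b ha hb
    simp only [Set.mem_setOf_eq, map_add] at *
    rw [ha, hb, smul_add]
  zero_mem' := by simp
  smul_mem' := by
    intro c u hu
    simp only [Set.mem_setOf_eq, map_smul] at *
    rw [hu, smul_comm]

/-- The `i`-eigenspace of the complexification of an endomorphism of `V ⊕ V*`. -/
def Hsp (H : Big V →ₗ[ℝ] Big V) : Submodule ℂ (Bc V) :=
  eigSp V (LinearMap.baseChange ℂ H) Complex.I

/-- The `+1`-eigenspace of the complexification of an endomorphism of `V ⊕ V*`. -/
def Fplus (F : Big V →ₗ[ℝ] Big V) : Submodule ℂ (Bc V) :=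
  eigSp V (LinearMap.baseChange ℂ F) 1

/-- The `-1`-eigenspace of the complexification of an endomorphism of `V ⊕ V*`. -/
def Fminus (F : Big V →ₗ[ℝ] Big V) : Submodule ℂ (Bc V) :=
  eigSp V (LinearMap.baseChange ℂ F) (-1)

/-- The graph `{(X, ψ^ℂ(X,·) + i γ₀^ℂ(X,·)) : X ∈ V^ℂ}` inside `(V ⊕ V*)^ℂ`.
An element `u = (X, α)` lies on the graph iff `α(Y) = ψ^ℂ(X,Y) + i γ₀^ℂ(X,Y)` for all
`Y ∈ V^ℂ`; the value `α(Y)` is expressed canonically as `2 g^ℂ(u, (Y,0))`. -/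
def graphSet (γ₀ ψ : LinearMap.BilinForm ℝ V) : Set (Bc V) :=
  {u | ∀ Y : Vc V, 2 * gc V u (inV V Y) =
      bcB V ψ (prV V u) Y + Complex.I * bcB V γ₀ (prV V u) Y}

/-- Complex conjugation of `(V ⊕ V*)^ℂ` with respect to the real form `V ⊕ V*`. -/
def conjMap : Bc V →ₗ[ℝ] Bc V := LinearMap.rTensor (Big V) Complex.conjAe.toLinearMap

/-- The complex conjugate of a complex subspace of `(V ⊕ V*)^ℂ` (the image of the
subspace under conjugation; taking the `ℂ`-span does not enlarge the image, since the
image of a complex subspace under conjugation is again a complex subspace). -/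
def conjSub (S : Submodule ℂ (Bc V)) : Submodule ℂ (Bc V) :=
  Submodule.span ℂ (conjMap V '' (S : Set (Bc V)))

noncomputable instance (S : Submodule ℂ (Bc V)) : AddCommGroup ↥S :=
  Module.addCommMonoidToAddCommGroup ℂ

/-- A `g`-isotropic subspace of `(V ⊕ V*)^ℂ`. -/
def IsIsotropic (S : Submodule ℂ (Bc V)) : Prop := ∀ u ∈ S, ∀ v ∈ S, gc V u v = 0

/-- A maximal `g`-isotropic subspace of `(V ⊕ V*)^ℂ`: a `g`-isotropic subspace of
complex dimension `dim V`. -/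
def MaxIsotropic (S : Submodule ℂ (Bc V)) : Prop :=
  IsIsotropic V S ∧ Module.finrank ℂ S = Module.finrank ℝ V

/-- The endomorphism of `V^ℂ` induced by an endomorphism `A` of `V ⊕ V*` via `τ`:
`X ↦ pr_{V^ℂ} (A^ℂ (τ X))`. -/
def Fop (A : Big V →ₗ[ℝ] Big V) (τ : Vc V →ₗ[ℂ] Bc V) : Vc V → Vc V :=
  fun X => prV V (LinearMap.baseChange ℂ A (τ X))

/-- The canonical (real) inclusion `V → V^ℂ`. -/
def realIncl : V →ₗ[ℝ] Vc V := TensorProduct.mk ℝ ℂ V 1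

/-- The canonical (real) inclusion `V ⊕ V* → (V ⊕ V*)^ℂ`. -/
def realInclB : Big V →ₗ[ℝ] Bc V := TensorProduct.mk ℝ ℂ (Big V) 1

/-- The B-field transformation `(X, α) ↦ (X, α + B(X,·))` of `V ⊕ V*`. -/
def Bfield (B : LinearMap.BilinForm ℝ V) : Big V →ₗ[ℝ] Big V :=
  LinearMap.prod (LinearMap.fst ℝ V (Module.Dual ℝ V))
    (LinearMap.snd ℝ V (Module.Dual ℝ V) + B ∘ₗ LinearMap.fst ℝ V (Module.Dual ℝ V))

/-- `(X, α) ↦ (F X, -α ∘ F)`. -/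
def genF (F : V →ₗ[ℝ] V) : Big V →ₗ[ℝ] Big V := F.prodMap (- F.dualMap)

/-- `(X, α) ↦ (♯ α, -γ₀(X,·))`. -/
def genH (γ₀ : LinearMap.BilinForm ℝ V) (sharp : Module.Dual ℝ V →ₗ[ℝ] V) :
    Big V →ₗ[ℝ] Big V :=
  LinearMap.prod (sharp ∘ₗ LinearMap.snd ℝ V (Module.Dual ℝ V))
    (- (γ₀ ∘ₗ LinearMap.fst ℝ V (Module.Dual ℝ V)))

/-- The projection `(1/4)(Id + 𝓕^ℂ) ∘ (Id - i 𝓗^ℂ)` onto `𝐇₊`, as a function. -/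
def prHplus (F H : Big V →ₗ[ℝ] Big V) (u : Bc V) : Bc V :=
  ((1 : ℂ)/4) • ((u - Complex.I • LinearMap.baseChange ℂ H u) +
    LinearMap.baseChange ℂ F (u - Complex.I • LinearMap.baseChange ℂ H u))

/-- The projection `(1/4)(Id - 𝓕^ℂ) ∘ (Id - i 𝓗^ℂ)` onto `𝐇₋`, as a function. -/
def prHminus (F H : Big V →ₗ[ℝ] Big V) (u : Bc V) : Bc V :=
  ((1 : ℂ)/4) • ((u - Complex.I • LinearMap.baseChange ℂ H u) -
    LinearMap.baseChange ℂ F (u - Complex.I • LinearMap.baseChange ℂ H u))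

/-- The inclusion `W ⊕ V* → V ⊕ V*` over a subspace `W ⊆ V`. -/
def bigIncl (W : Submodule ℝ V) : (↥W × Module.Dual ℝ V) →ₗ[ℝ] Big V :=
  (W.subtype).prodMap LinearMap.id

/-- The restriction `W ⊕ V* → W ⊕ W*`, restricting functionals to `W`. -/
def bigRes (W : Submodule ℝ V) : (↥W × Module.Dual ℝ V) →ₗ[ℝ] Big ↥W :=
  LinearMap.prodMap LinearMap.id (W.subtype.dualMap)

/-- The pullback `ι*U = {(X, η∘ι) : X ∈ W^ℂ, (X, η) ∈ U}` of a subspace of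
`(V ⊕ V*)^ℂ` to `(W ⊕ W*)^ℂ`. -/
def pullback (W : Submodule ℝ V) (U : Submodule ℂ (Bc V)) : Submodule ℂ (Bc ↥W) :=
  Submodule.map (LinearMap.baseChange ℂ (bigRes V W))
    (Submodule.comap (LinearMap.baseChange ℂ (bigIncl V W)) U)

/-- Restriction of a bilinear form on `V` to a subspace `W`. -/
def resB (W : Submodule ℝ V) (B : LinearMap.BilinForm ℝ V) : LinearMap.BilinForm ℝ ↥W :=
  B.compl₁₂ W.subtype W.subtype

section

variable {V}

theorem two_mul_gc_eq (u v : Bc V) :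
    2 * gc V u v = 2 * gc V u (inV V (prV V v)) + 2 * gc V v (inV V (prV V u)) := by
  induction u using TensorProduct.induction_on with
  | zero => simp
  | add a b ha hb =>
    simp only [map_add, LinearMap.add_apply, mul_add] at ha hb ⊢
    rw [ha, hb]
    ring
  | tmul z a =>
    induction v using TensorProduct.induction_on with
    | zero => simp
    | add c d hc hd =>
      simp only [map_add, LinearMap.add_apply, mul_add] at hc hd ⊢
      rw [hc, hd]
      ring
    | tmul w b =>
      simp [gc, gP, inV, prV]
      ring

theorem bcB_comm_of_symm {B : LinearMap.BilinForm ℝ V} (hB : ∀ x y, B x y = B y x)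
    (X Y : Vc V) : bcB V B X Y = bcB V B Y X := by
  induction X using TensorProduct.induction_on with
  | zero => simp
  | add a b ha hb => simp only [map_add, LinearMap.add_apply, ha, hb]
  | tmul z a =>
    induction Y using TensorProduct.induction_on with
    | zero => simp
    | add c d hc hd => simp only [map_add, LinearMap.add_apply, hc, hd]
    | tmul w b => simp [bcB, hB a b, mul_comm z w]

theorem bcB_neg_comm_of_antisymm {B : LinearMap.BilinForm ℝ V} (hB : ∀ x y, B x y = -B y x)
    (X Y : Vc V) : bcB V B X Y = -bcB V B Y X := by
  induction X using TensorProduct.induction_on with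
  | zero => simp
  | add a b ha hb => simp only [map_add, LinearMap.add_apply, ha, hb, neg_add]
  | tmul z a =>
    induction Y using TensorProduct.induction_on with
    | zero => simp
    | add c d hc hd => simp only [map_add, LinearMap.add_apply, hc, hd, neg_add]
    | tmul w b => simp [bcB, hB a b, mul_comm z w]

theorem gc_baseChange_skew {A : Big V →ₗ[ℝ] Big V} (hA : ∀ u v, gP V (A u) v = -gP V u (A v))
    (u v : Bc V) :
    gc V (LinearMap.baseChange ℂ A u) v = -gc V u (LinearMap.baseChange ℂ A v) := by
  induction u using TensorProduct.induction_on with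
  | zero => simp
  | add a b ha hb => simp only [map_add, LinearMap.add_apply, ha, hb, neg_add]
  | tmul z a =>
    induction v using TensorProduct.induction_on with
    | zero => simp
    | add c d hc hd => simp only [map_add, hc, hd, neg_add]
    | tmul w b => simp [gc, hA a b]

/-- On two points of the graph, the pairing metric is `i γ₀^ℂ` of the projections. -/
theorem gc_eq_of_mem_graphSet {γ₀ ψ : LinearMap.BilinForm ℝ V}
    (hsym : ∀ x y, γ₀ x y = γ₀ y x) (hanti : ∀ x y, ψ x y = -ψ y x)
    {u v : Bc V} (hu : u ∈ graphSet V γ₀ ψ) (hv : v ∈ graphSet V γ₀ ψ) :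
    gc V u v = Complex.I * bcB V γ₀ (prV V u) (prV V v) := by
  have h := two_mul_gc_eq u v
  rw [hu, hv, bcB_comm_of_symm hsym (prV V v), bcB_neg_comm_of_antisymm hanti (prV V v)] at h
  linear_combination h / 2

theorem baseChange_eq_I_smul_of_mem_Hsp {F J : Big V →ₗ[ℝ] Big V}
    (hF : F ∘ₗ F = LinearMap.id) (hFJ : F ∘ₗ J = J ∘ₗ F) {u : Bc V} (hu : u ∈ Hsp V (J ∘ₗ F)) :
    LinearMap.baseChange ℂ J u = Complex.I • LinearMap.baseChange ℂ F u := by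
  have hu' : LinearMap.baseChange ℂ (J ∘ₗ F) u = Complex.I • u := hu
  have hJ : J = F ∘ₗ (J ∘ₗ F) := by
    rw [← hFJ, ← LinearMap.comp_assoc, hF, LinearMap.id_comp]
  conv_lhs => rw [hJ, LinearMap.baseChange_comp, LinearMap.comp_apply, hu', map_smul]

theorem baseChange_mem_Hsp {F J : Big V →ₗ[ℝ] Big V} (hFJ : F ∘ₗ J = J ∘ₗ F) {u : Bc V}
    (hu : u ∈ Hsp V (J ∘ₗ F)) : LinearMap.baseChange ℂ J u ∈ Hsp V (J ∘ₗ F) := by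
  have hu' : LinearMap.baseChange ℂ (J ∘ₗ F) u = Complex.I • u := hu
  change LinearMap.baseChange ℂ (J ∘ₗ F) (LinearMap.baseChange ℂ J u) = _
  rw [← LinearMap.comp_apply, ← LinearMap.baseChange_comp, LinearMap.comp_assoc, hFJ,
    LinearMap.baseChange_comp, LinearMap.comp_apply, hu', map_smul]

end

/-- With the setup of a generalized almost para-Hermitian structure
`(𝓕, 𝓙)` with `𝐇` and `τ` as above, and `F X = pr_{V^ℂ}(𝓕^ℂ(τ X))`,
`J X = pr_{V^ℂ}(𝓙^ℂ(τ X))`, one has `J = i F`; in particular `J² = -Id` and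
`γ₀^ℂ(J X, Y) + γ₀^ℂ(X, J Y) = 0`. -/
theorem induced_J_eq_i_F (V : Type) [AddCommGroup V] [Module ℝ V]
    [FiniteDimensional ℝ V]
    (𝓕 𝓙 : Big V →ₗ[ℝ] Big V) (h : IsGAPH V 𝓕 𝓙)
    (γ₀ ψ : LinearMap.BilinForm ℝ V)
    (hsym : ∀ x y, γ₀ x y = γ₀ y x) (hnd : ∀ x, (∀ y, γ₀ x y = 0) → x = 0)
    (hanti : ∀ x y, ψ x y = - ψ y x)
    (τ : Vc V →ₗ[ℂ] Bc V)
    (hτmem : ∀ X, τ X ∈ Hsp V (𝓙 ∘ₗ 𝓕))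
    (hτonto : ∀ u ∈ Hsp V (𝓙 ∘ₗ 𝓕), ∃ X, τ X = u)
    (hτpr : ∀ X, prV V (τ X) = X)
    (hτgraph : ∀ X, τ X ∈ graphSet V γ₀ ψ) :
    (∀ X, Fop V 𝓙 τ X = Complex.I • Fop V 𝓕 τ X) ∧
    (∀ X, Fop V 𝓙 τ (Fop V 𝓙 τ X) = - X) ∧
    (∀ X Y, bcB V γ₀ (Fop V 𝓙 τ X) Y + bcB V γ₀ X (Fop V 𝓙 τ Y) = 0) := by
  obtain ⟨⟨hF, -⟩, ⟨hJ, hJskew⟩, hFJ, -⟩ := h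
  have hτJ (X) : τ (Fop V 𝓙 τ X) = LinearMap.baseChange ℂ 𝓙 (τ X) := by
    obtain ⟨Z, hZ⟩ := hτonto _ (baseChange_mem_Hsp hFJ (hτmem X))
    rw [Fop, ← hZ, hτpr]
  have hg (X Y) : gc V (τ X) (τ Y) = Complex.I * bcB V γ₀ X Y := by
    rw [gc_eq_of_mem_graphSet hsym hanti (hτgraph X) (hτgraph Y), hτpr, hτpr]
  refine ⟨fun X => ?_, fun X => ?_, fun X Y => ?_⟩
  · rw [Fop, Fop, baseChange_eq_I_smul_of_mem_Hsp hF hFJ (hτmem X), map_smul]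
  · rw [Fop, hτJ, ← LinearMap.comp_apply (LinearMap.baseChange ℂ 𝓙),
      ← LinearMap.baseChange_comp, hJ, LinearMap.baseChange_neg, LinearMap.baseChange_id,
      LinearMap.neg_apply, LinearMap.id_apply, map_neg, hτpr]
  · have h := gc_baseChange_skew hJskew (τ X) (τ Y)
    rw [← hτJ, ← hτJ, hg, hg] at h
    exact mul_left_cancel₀ Complex.I_ne_zero (by linear_combination h)
end
end

section
/- Let (𝓕, 𝓙) be a generalized almost para-Hermitian structure on a finite-dimensional real vector space V, and let F, J ∈ End(V^ℂ) be the associated endomorphisms F X = pr_{V^ℂ}(𝓕^ℂ(τ X)), J X = pr_{V^ℂ}(𝓙^ℂ(τ X)). Then F is real (i.e., F maps V into V inside V^ℂ) if and only if pr_V ∘ 𝓕 ∘ incl_{V*} = 0, i.e. 𝓕(0 ⊕ V*) ⊆ 0 ⊕ V*; similarly J is real if and only if pr_V ∘ 𝓙 ∘ incl_{V*} = 0. -/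
noncomputable section

open TensorProduct

attribute [local instance 3000] TensorProduct.addCommMonoid TensorProduct.leftModule

variable (V : Type) [AddCommGroup V] [Module ℝ V]

/-- Every element of a complexification is of the form `1 ⊗ u + i ⊗ v`. -/
lemma exists_eq_one_tmul_add_I_tmul {W : Type} [AddCommGroup W] [Module ℝ W] (z : ℂ ⊗[ℝ] W) :
    ∃ u v : W, z = (1 : ℂ) ⊗ₜ[ℝ] u + Complex.I ⊗ₜ[ℝ] v := by
  induction z using TensorProduct.induction_on with
  | zero => exact ⟨0, 0, by simp⟩
  | tmul c w =>
    refine ⟨c.re • w, c.im • w, ?_⟩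
    rw [← TensorProduct.smul_tmul, ← TensorProduct.smul_tmul, ← TensorProduct.add_tmul]
    congr 1
    apply Complex.ext <;> simp
  | add a b ha hb =>
    obtain ⟨u, v, rfl⟩ := ha
    obtain ⟨u', v', rfl⟩ := hb
    refine ⟨u + u', v + v', ?_⟩
    rw [TensorProduct.tmul_add, TensorProduct.tmul_add]
    abel

/-- The real part of an element of a complexification. -/
def tensorRe (W : Type) [AddCommGroup W] [Module ℝ W] : ℂ ⊗[ℝ] W →ₗ[ℝ] W :=
  (TensorProduct.lid ℝ W).toLinearMap ∘ₗ LinearMap.rTensor W Complex.reLm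

/-- The imaginary part of an element of a complexification. -/
def tensorIm (W : Type) [AddCommGroup W] [Module ℝ W] : ℂ ⊗[ℝ] W →ₗ[ℝ] W :=
  (TensorProduct.lid ℝ W).toLinearMap ∘ₗ LinearMap.rTensor W Complex.imLm

lemma tensorRe_tmul {W : Type} [AddCommGroup W] [Module ℝ W] (c : ℂ) (w : W) :
    tensorRe W (c ⊗ₜ[ℝ] w) = c.re • w := by
  simp [tensorRe]

lemma tensorIm_tmul {W : Type} [AddCommGroup W] [Module ℝ W] (c : ℂ) (w : W) :
    tensorIm W (c ⊗ₜ[ℝ] w) = c.im • w := by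
  simp [tensorIm]

/-- `1 ⊗ u + i ⊗ v` is real iff `v = 0`. -/
lemma one_tmul_add_I_tmul_mem_range_realIncl {V : Type} [AddCommGroup V] [Module ℝ V] (u v : V) :
    (1 : ℂ) ⊗ₜ[ℝ] u + Complex.I ⊗ₜ[ℝ] v ∈ LinearMap.range (realIncl V) ↔ v = 0 := by
  constructor
  · rintro ⟨w, hw⟩
    simpa [realIncl, tensorIm_tmul] using (congrArg (tensorIm V) hw).symm
  · rintro rfl
    exact ⟨u, by simp [realIncl]⟩

/-- A point of the graph over a real vector `x` is `(x, ψ(x,·)) + i (0, γ₀(x,·))`. -/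
lemma eq_of_mem_graphSet {V : Type} [AddCommGroup V] [Module ℝ V]
    {γ₀ ψ : LinearMap.BilinForm ℝ V} {z : Bc V} {x : V}
    (hpr : prV V z = realIncl V x) (hz : z ∈ graphSet V γ₀ ψ) :
    z = (1 : ℂ) ⊗ₜ[ℝ] ((x, ψ x) : Big V) + Complex.I ⊗ₜ[ℝ] (((0 : V), γ₀ x) : Big V) := by
  obtain ⟨⟨a, α⟩, ⟨b, β⟩, rfl⟩ := exists_eq_one_tmul_add_I_tmul z
  have hp : (1 : ℂ) ⊗ₜ[ℝ] a + Complex.I ⊗ₜ[ℝ] b = (1 : ℂ) ⊗ₜ[ℝ] x := by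
    simpa [prV, realIncl] using hpr
  have ha : a = x := by simpa [tensorRe_tmul] using congrArg (tensorRe V) hp
  have hb : b = 0 := by simpa [tensorIm_tmul] using congrArg (tensorIm V) hp
  subst ha hb
  have key (y : V) : (α y : ℂ) + Complex.I * β y = ψ a y + Complex.I * γ₀ a y := by
    have h := hz (realIncl V y)
    rw [hpr] at h
    simp [gc, bcB, inV, realIncl, gP] at h
    rw [← h]
    ring
  have hα : α = ψ a := LinearMap.ext fun y => by simpa using congrArg Complex.re (key y)
  have hβ : β = γ₀ a := LinearMap.ext fun y => by simpa using congrArg Complex.im (key y)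
  rw [hα, hβ]

/-- The endomorphism of `V^ℂ` induced by `A` via the graph map `τ` is real iff
`A (0 ⊕ V*) ⊆ 0 ⊕ V*`. -/
lemma Fop_real_iff {V : Type} [AddCommGroup V] [Module ℝ V] [FiniteDimensional ℝ V]
    {γ₀ ψ : LinearMap.BilinForm ℝ V} (hnd : ∀ x, (∀ y, γ₀ x y = 0) → x = 0)
    {τ : Vc V →ₗ[ℂ] Bc V} (hτpr : ∀ X, prV V (τ X) = X)
    (hτgraph : ∀ X, τ X ∈ graphSet V γ₀ ψ) (A : Big V →ₗ[ℝ] Big V) :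
    (∀ x : V, Fop V A τ (realIncl V x) ∈ LinearMap.range (realIncl V)) ↔
      ∀ α : Module.Dual ℝ V, (A ((0 : V), α)).1 = 0 := by
  have hsurj : Function.Surjective γ₀ := by
    have hinj : Function.Injective γ₀ :=
      (injective_iff_map_eq_zero γ₀).2 fun x hx => hnd x fun y => by simp [hx]
    exact (LinearMap.injective_iff_surjective_of_finrank_eq_finrank
      Subspace.dual_finrank_eq.symm).1 hinj
  have hF (x : V) : Fop V A τ (realIncl V x) =
      (1 : ℂ) ⊗ₜ[ℝ] (A (x, ψ x)).1 + Complex.I ⊗ₜ[ℝ] (A ((0 : V), γ₀ x)).1 := by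
    rw [Fop, eq_of_mem_graphSet (hτpr _) (hτgraph _)]
    simp [prV]
  simp only [hF, one_tmul_add_I_tmul_mem_range_realIncl]
  exact (hsurj.forall (p := fun α => (A ((0 : V), α)).1 = 0)).symm

/-- With the setup of a generalized almost para-Hermitian structure
`(𝓕, 𝓙)` with associated `τ`, the induced endomorphism `F = pr_{V^ℂ} ∘ 𝓕^ℂ ∘ τ` is real
(maps `V ⊆ V^ℂ` into `V`) iff `𝓕(0 ⊕ V*) ⊆ 0 ⊕ V*`; similarly `J = pr_{V^ℂ} ∘ 𝓙^ℂ ∘ τ`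
is real iff `𝓙(0 ⊕ V*) ⊆ 0 ⊕ V*`. -/
theorem induced_F_real_iff (V : Type) [AddCommGroup V] [Module ℝ V]
    [FiniteDimensional ℝ V]
    (𝓕 𝓙 : Big V →ₗ[ℝ] Big V) (h : IsGAPH V 𝓕 𝓙)
    (γ₀ ψ : LinearMap.BilinForm ℝ V)
    (hsym : ∀ x y, γ₀ x y = γ₀ y x) (hnd : ∀ x, (∀ y, γ₀ x y = 0) → x = 0)
    (hanti : ∀ x y, ψ x y = - ψ y x)
    (τ : Vc V →ₗ[ℂ] Bc V)
    (hτmem : ∀ X, τ X ∈ Hsp V (𝓙 ∘ₗ 𝓕))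
    (hτonto : ∀ u ∈ Hsp V (𝓙 ∘ₗ 𝓕), ∃ X, τ X = u)
    (hτpr : ∀ X, prV V (τ X) = X)
    (hτgraph : ∀ X, τ X ∈ graphSet V γ₀ ψ) :
    ((∀ x : V, Fop V 𝓕 τ (realIncl V x) ∈ LinearMap.range (realIncl V)) ↔
      (∀ α : Module.Dual ℝ V, (𝓕 ((0 : V), α)).1 = 0)) ∧
    ((∀ x : V, Fop V 𝓙 τ (realIncl V x) ∈ LinearMap.range (realIncl V)) ↔
      (∀ α : Module.Dual ℝ V, (𝓙 ((0 : V), α)).1 = 0)) := by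
  exact ⟨Fop_real_iff hnd hτpr hτgraph 𝓕, Fop_real_iff hnd hτpr hτgraph 𝓙⟩
end
end

section
/- Let (𝓕, 𝓙) be a generalized almost para-Hermitian structure on a finite-dimensional real vector space V, with associated triple (γ₀, ψ, F). For a real antisymmetric bilinear form B on V, let 𝓑 be the endomorphism of V ⊕ V* given by 𝓑(X, α) = (X, α + B(X,·)), and set 𝓕^B = 𝓑⁻¹∘𝓕∘𝓑, 𝓙^B = 𝓑⁻¹∘𝓙∘𝓑. Then (𝓕^B, 𝓙^B) is again a generalized almost para-Hermitian structure on V, and its associated triple is (γ₀, ψ - B, F); in particular the B-field transformation preserves γ₀ and F and sends ψ to ψ - B. -/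
noncomputable section

open TensorProduct

attribute [local instance 3000] TensorProduct.addCommMonoid TensorProduct.leftModule

variable (V : Type) [AddCommGroup V] [Module ℝ V]

section BField

variable {V : Type} [AddCommGroup V] [Module ℝ V]

theorem gP_apply (u v : Big V) : gP V u v = (u.2 v.1 + v.2 u.1) / 2 := rfl

theorem Bfield_apply (B : LinearMap.BilinForm ℝ V) (u : Big V) :
    Bfield V B u = (u.1, u.2 + B u.1) := rfl

theorem Bfield_zero_left (B : LinearMap.BilinForm ℝ V) (α : Module.Dual ℝ V) :
    Bfield V B (0, α) = (0, α) := by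
  simp [Bfield_apply]

theorem Bfield_comp_Bfield_neg (B : LinearMap.BilinForm ℝ V) :
    Bfield V B ∘ₗ Bfield V (-B) = LinearMap.id := by
  refine LinearMap.ext fun u => Prod.ext rfl ?_
  simp [Bfield_apply]

theorem Bfield_neg_comp_Bfield (B : LinearMap.BilinForm ℝ V) :
    Bfield V (-B) ∘ₗ Bfield V B = LinearMap.id := by
  refine LinearMap.ext fun u => Prod.ext rfl ?_
  simp [Bfield_apply]

theorem Bfield_Bfield_neg (B : LinearMap.BilinForm ℝ V) (u : Big V) :
    Bfield V B (Bfield V (-B) u) = u :=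
  LinearMap.congr_fun (Bfield_comp_Bfield_neg B) u

theorem gP_Bfield_left {B : LinearMap.BilinForm ℝ V} (hB : ∀ x y, B x y = - B y x)
    (u v : Big V) : gP V (Bfield V B u) v = gP V u (Bfield V (-B) v) := by
  simp only [gP_apply, Bfield_apply, LinearMap.add_apply, LinearMap.neg_apply]
  rw [hB u.1 v.1]
  ring

theorem gP_Bfield_neg_left {B : LinearMap.BilinForm ℝ V} (hB : ∀ x y, B x y = - B y x)
    (u v : Big V) : gP V (Bfield V (-B) u) v = gP V u (Bfield V B v) := by
  simp only [gP_apply, Bfield_apply, LinearMap.add_apply, LinearMap.neg_apply]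
  rw [hB u.1 v.1]
  ring

theorem Bfield_conj_comp (B : LinearMap.BilinForm ℝ V) (S T : Big V →ₗ[ℝ] Big V) :
    (Bfield V (-B) ∘ₗ S ∘ₗ Bfield V B) ∘ₗ (Bfield V (-B) ∘ₗ T ∘ₗ Bfield V B) =
      Bfield V (-B) ∘ₗ (S ∘ₗ T) ∘ₗ Bfield V B := by
  refine LinearMap.ext fun u => ?_
  simp only [LinearMap.comp_apply, Bfield_Bfield_neg]

theorem gP_Bfield_conj_skew {B : LinearMap.BilinForm ℝ V} (hB : ∀ x y, B x y = - B y x)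
    {T : Big V →ₗ[ℝ] Big V} (hT : ∀ u v, gP V (T u) v = - gP V u (T v)) (u v : Big V) :
    gP V ((Bfield V (-B) ∘ₗ T ∘ₗ Bfield V B) u) v =
      - gP V u ((Bfield V (-B) ∘ₗ T ∘ₗ Bfield V B) v) := by
  simp only [LinearMap.comp_apply]
  rw [gP_Bfield_neg_left hB, hT, gP_Bfield_left hB]

theorem gammaOf_Bfield_conj {B : LinearMap.BilinForm ℝ V} (hB : ∀ x y, B x y = - B y x)
    (S T : Big V →ₗ[ℝ] Big V) (α β : Module.Dual ℝ V) :
    gammaOf V (Bfield V (-B) ∘ₗ S ∘ₗ Bfield V B) (Bfield V (-B) ∘ₗ T ∘ₗ Bfield V B) α β =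
      gammaOf V S T α β := by
  simp only [gammaOf, LinearMap.comp_apply, Bfield_zero_left]
  rw [gP_Bfield_neg_left hB, Bfield_Bfield_neg]

theorem IsGAPH.Bfield_conj {B : LinearMap.BilinForm ℝ V} (hB : ∀ x y, B x y = - B y x)
    {S T : Big V →ₗ[ℝ] Big V} (h : IsGAPH V S T) :
    IsGAPH V (Bfield V (-B) ∘ₗ S ∘ₗ Bfield V B) (Bfield V (-B) ∘ₗ T ∘ₗ Bfield V B) := by
  obtain ⟨⟨hS, hS'⟩, ⟨hT, hT'⟩, hST, hγ⟩ := h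
  refine ⟨⟨?_, gP_Bfield_conj_skew hB hS'⟩, ⟨?_, gP_Bfield_conj_skew hB hT'⟩, ?_, ?_⟩
  · rw [Bfield_conj_comp, hS, LinearMap.id_comp, Bfield_neg_comp_Bfield]
  · rw [Bfield_conj_comp, hT, LinearMap.neg_comp, LinearMap.comp_neg, LinearMap.id_comp,
      Bfield_neg_comp_Bfield]
  · rw [Bfield_conj_comp, Bfield_conj_comp, hST]
  · simpa only [gammaOf_Bfield_conj hB] using hγ

theorem prV_baseChange_Bfield (B : LinearMap.BilinForm ℝ V) (u : Bc V) :
    prV V (LinearMap.baseChange ℂ (Bfield V B) u) = prV V u := by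
  rw [prV, ← LinearMap.comp_apply, ← LinearMap.baseChange_comp]
  rfl

theorem baseChange_Bfield_conj_apply (B : LinearMap.BilinForm ℝ V) (T : Big V →ₗ[ℝ] Big V)
    (u : Bc V) :
    LinearMap.baseChange ℂ (Bfield V (-B) ∘ₗ T ∘ₗ Bfield V B) u =
      LinearMap.baseChange ℂ (Bfield V (-B))
        (LinearMap.baseChange ℂ T (LinearMap.baseChange ℂ (Bfield V B) u)) := by
  simp only [LinearMap.baseChange_comp, LinearMap.comp_apply]

theorem baseChange_Bfield_Bfield_neg (B : LinearMap.BilinForm ℝ V) (u : Bc V) :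
    LinearMap.baseChange ℂ (Bfield V B) (LinearMap.baseChange ℂ (Bfield V (-B)) u) = u := by
  rw [← LinearMap.comp_apply, ← LinearMap.baseChange_comp, Bfield_comp_Bfield_neg,
    LinearMap.baseChange_id, LinearMap.id_apply]

theorem baseChange_Bfield_neg_Bfield (B : LinearMap.BilinForm ℝ V) (u : Bc V) :
    LinearMap.baseChange ℂ (Bfield V (-B)) (LinearMap.baseChange ℂ (Bfield V B) u) = u := by
  rw [← LinearMap.comp_apply, ← LinearMap.baseChange_comp, Bfield_neg_comp_Bfield,
    LinearMap.baseChange_id, LinearMap.id_apply]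

theorem mem_Hsp_Bfield_conj (B : LinearMap.BilinForm ℝ V) (T : Big V →ₗ[ℝ] Big V) (u : Bc V) :
    u ∈ Hsp V (Bfield V (-B) ∘ₗ T ∘ₗ Bfield V B) ↔
      LinearMap.baseChange ℂ (Bfield V B) u ∈ Hsp V T := by
  change LinearMap.baseChange ℂ (Bfield V (-B) ∘ₗ T ∘ₗ Bfield V B) u = Complex.I • u ↔
    LinearMap.baseChange ℂ T (LinearMap.baseChange ℂ (Bfield V B) u) =
      Complex.I • LinearMap.baseChange ℂ (Bfield V B) u
  rw [baseChange_Bfield_conj_apply]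
  constructor
  · intro h
    rw [← map_smul, ← h, baseChange_Bfield_Bfield_neg]
  · intro h
    rw [h, map_smul, baseChange_Bfield_neg_Bfield]

theorem two_mul_gc_baseChange_Bfield_inV (B : LinearMap.BilinForm ℝ V) (u : Bc V) (Y : Vc V) :
    2 * gc V (LinearMap.baseChange ℂ (Bfield V B) u) (inV V Y) =
      2 * gc V u (inV V Y) + bcB V B (prV V u) Y := by
  induction u using TensorProduct.induction_on with
  | zero => simp
  | add u₁ u₂ h₁ h₂ =>
    simp only [map_add, LinearMap.add_apply, mul_add, h₁, h₂]
    ring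
  | tmul a w =>
    induction Y using TensorProduct.induction_on with
    | zero => simp
    | add Y₁ Y₂ h₁ h₂ =>
      simp only [map_add, mul_add, h₁, h₂]
      ring
    | tmul b y =>
      simp [gc, bcB, inV, prV, gP_apply, Bfield_apply, LinearMap.BilinForm.baseChange_tmul]
      ring

theorem bcB_sub_apply (ψ B : LinearMap.BilinForm ℝ V) (X Y : Vc V) :
    bcB V (ψ - B) X Y = bcB V ψ X Y - bcB V B X Y := by
  induction X using TensorProduct.induction_on with
  | zero => simp
  | add X₁ X₂ h₁ h₂ =>
    simp only [map_add, LinearMap.add_apply, h₁, h₂]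
    ring
  | tmul a x =>
    induction Y using TensorProduct.induction_on with
    | zero => simp
    | add Y₁ Y₂ h₁ h₂ =>
      simp only [map_add, h₁, h₂]
      ring
    | tmul b y =>
      simp [bcB, LinearMap.BilinForm.baseChange_tmul]
      ring

theorem mem_graphSet_sub_iff (γ₀ ψ B : LinearMap.BilinForm ℝ V) (u : Bc V) :
    u ∈ graphSet V γ₀ (ψ - B) ↔
      LinearMap.baseChange ℂ (Bfield V B) u ∈ graphSet V γ₀ ψ := by
  refine forall_congr' fun Y => ?_
  rw [two_mul_gc_baseChange_Bfield_inV, prV_baseChange_Bfield, bcB_sub_apply,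
    ← eq_sub_iff_add_eq, add_sub_right_comm]

end BField

/-- The B-field transformation `𝓕 ↦ 𝓑⁻¹∘𝓕∘𝓑`, `𝓙 ↦ 𝓑⁻¹∘𝓙∘𝓑`, with
`𝓑(X,α) = (X, α + B(X,·))` (whose inverse is the B-field transformation of `-B`), sends
a generalized almost para-Hermitian structure with triple `(γ₀, ψ, F)` to a generalized
almost para-Hermitian structure with triple `(γ₀, ψ - B, F)`. -/
theorem bfield_transform (V : Type) [AddCommGroup V] [Module ℝ V]
    [FiniteDimensional ℝ V]
    (𝓕 𝓙 : Big V →ₗ[ℝ] Big V) (h : IsGAPH V 𝓕 𝓙)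
    (γ₀ ψ B : LinearMap.BilinForm ℝ V)
    (hsym : ∀ x y, γ₀ x y = γ₀ y x) (hnd : ∀ x, (∀ y, γ₀ x y = 0) → x = 0)
    (hanti : ∀ x y, ψ x y = - ψ y x) (hBanti : ∀ x y, B x y = - B y x)
    (F : Vc V →ₗ[ℂ] Vc V)
    (hgraph : (Hsp V (𝓙 ∘ₗ 𝓕) : Set (Bc V)) = graphSet V γ₀ ψ)
    (hFchar : ∀ u ∈ Hsp V (𝓙 ∘ₗ 𝓕), prV V (LinearMap.baseChange ℂ 𝓕 u) = F (prV V u)) :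
    IsGAPH V (Bfield V (-B) ∘ₗ 𝓕 ∘ₗ Bfield V B) (Bfield V (-B) ∘ₗ 𝓙 ∘ₗ Bfield V B) ∧
    ((Hsp V ((Bfield V (-B) ∘ₗ 𝓙 ∘ₗ Bfield V B) ∘ₗ (Bfield V (-B) ∘ₗ 𝓕 ∘ₗ Bfield V B)) :
        Set (Bc V)) = graphSet V γ₀ (ψ - B)) ∧
    (∀ u ∈ Hsp V ((Bfield V (-B) ∘ₗ 𝓙 ∘ₗ Bfield V B) ∘ₗ (Bfield V (-B) ∘ₗ 𝓕 ∘ₗ Bfield V B)),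
      prV V (LinearMap.baseChange ℂ (Bfield V (-B) ∘ₗ 𝓕 ∘ₗ Bfield V B) u) = F (prV V u)) := by
  rw [Bfield_conj_comp]
  refine ⟨h.Bfield_conj hBanti, Set.ext fun u => ?_, fun u hu => ?_⟩
  · rw [mem_graphSet_sub_iff, ← hgraph]
    exact mem_Hsp_Bfield_conj B _ u
  · rw [baseChange_Bfield_conj_apply, prV_baseChange_Bfield,
      hFchar _ ((mem_Hsp_Bfield_conj B _ u).1 hu), prV_baseChange_Bfield]
end
end
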